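/- Let A be a ring and δ an isomorphism-invariant assignment of a value δ(M) ∈ {−∞} ∪ ℤ to every left A-module. Say a left A-module M is δ-pure of dimension q if every nonzero submodule M′ ⊆ M satisfies δ(M′) = q. Let I be a cochain complex of left A-modules such that for every n the module I^n is δ-pure of dimension −n. Then for every n the kernel of the differential d^n : I^n → I^{n+1} is an essential submodule of I^n. In particular, if in addition every I^n is an injective module, then I is a minimal injective complex. -/

import Mathlib

universe v

/-- A submodule `N` of a module `M` is *essential* if it meets every nonzero submodule of `M`
nontrivially, i.e. `N' ⊓ N = ⊥` forces `N' = ⊥`. -/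
def Submodule.IsEssential' {A : Type*} [Ring A] {M : Type*} [AddCommGroup M] [Module A M]
    (N : Submodule A M) : Prop :=
  ∀ N' : Submodule A M, N' ⊓ N = ⊥ → N' = ⊥

/-- Let `A` be a ring and `δ` an isomorphism-invariant assignment of a value
`δ(M) ∈ {−∞} ∪ ℤ` to every left `A`-module.  Say a module `M` is `δ`-pure of dimension `q` if
every nonzero submodule `M′ ⊆ M` satisfies `δ(M′) = q`.  Let `I` be a cochain complex of left
`A`-modules (differentials `d n : I n → I (n+1)` with `d ∘ d = 0`) such that each `I n` is
`δ`-pure of dimension `−n`.  Then for every `n` the kernel of `d n` is an essential submodule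
of `I n`.  In particular, if in addition every `I n` is injective, then `I` is a minimal
injective complex (each term injective with essential kernel of the differential). -/
theorem cousin_complex_ker_essential
    (A : Type v) [Ring A]
    (δ : (M : Type v) → [AddCommGroup M] → [Module A M] → WithBot ℤ)
    (hiso : ∀ (M N : Type v) [AddCommGroup M] [Module A M] [AddCommGroup N] [Module A N],
      Nonempty (M ≃ₗ[A] N) → δ M = δ N)
    (I : ℤ → Type v) [∀ n, AddCommGroup (I n)] [∀ n, Module A (I n)]
    (d : ∀ n : ℤ, I n →ₗ[A] I (n + 1))
    (hdd : ∀ n : ℤ, (d (n + 1)).comp (d n) = 0)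
    (hpure : ∀ (n : ℤ) (N : Submodule A (I n)), N ≠ ⊥ → δ N = ((-n : ℤ) : WithBot ℤ)) :
    (∀ n : ℤ, (LinearMap.ker (d n)).IsEssential') ∧
      ((∀ n : ℤ, Module.Injective A (I n)) →
        ∀ n : ℤ, Module.Injective A (I n) ∧ (LinearMap.ker (d n)).IsEssential') := by
  have hess : ∀ n : ℤ, (LinearMap.ker (d n)).IsEssential' := by
    intro n N hN
    by_contra hne
    have hinj : Function.Injective ((d n).domRestrict N) := by
      rw [LinearMap.injective_domRestrict_iff, disjoint_iff]
      exact hN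
    have hrange : LinearMap.range ((d n).domRestrict N) ≠ ⊥ := by
      intro h
      refine hne ((Submodule.eq_bot_iff N).2 fun x hx => ?_)
      have h0 : (d n).domRestrict N ⟨x, hx⟩ = (d n).domRestrict N 0 := by
        rw [LinearMap.range_eq_bot.1 h, LinearMap.zero_apply, LinearMap.zero_apply]
      exact congrArg Subtype.val (hinj h0)
    have hδ := hiso _ _ ⟨LinearEquiv.ofInjective ((d n).domRestrict N) hinj⟩
    rw [hpure n N hne, hpure (n + 1) _ hrange, WithBot.coe_inj] at hδ
    omega
  exact ⟨hess, fun hI n => ⟨hI n, hess n⟩⟩
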